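/- arXiv:1507.08080 — 2 statements merged into one kernel-verified Lean document; each statement's English description precedes it below -/
import Mathlib

section
/- Let P, Q : Fin 4 → ℝ² be two configurations of 4 labeled points (injective, in general position). If there are three distinct indices i, j, k ∈ Fin 4 such that the counterclockwise radial relations of P and Q agree at each of i, j, and k, then the counterclockwise radial relations of P and Q also agree at the fourth index. That is, for a 4-point configuration, the counterclockwise radial relation at any one point is uniquely determined by the counterclockwise radial relations at the other three points. -/
noncomputable def det2 (v w : ℝ × ℝ) : ℝ := v.1 * w.2 - v.2 * w.1

noncomputable def chi {α : Type*} (P : α → ℝ × ℝ) (i j k : α) : ℝ :=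
  Real.sign (det2 (P j - P i) (P k - P i))

def GenPos {α : Type*} (P : α → ℝ × ℝ) : Prop :=
  ∀ i j k : α, i ≠ j → i ≠ k → j ≠ k → chi P i j k ≠ 0

def Ccw {α : Type*} (P : α → ℝ × ℝ) (i j k l : α) : Prop :=
  (chi P i j k = 1 ∧ chi P i k l = 1) ∨
  (chi P i k l = 1 ∧ chi P i l j = 1) ∨
  (chi P i l j = 1 ∧ chi P i j k = 1)

def Admissible {α : Type*} (i j k l : α) : Prop :=
  i ≠ j ∧ i ≠ k ∧ i ≠ l ∧ j ≠ k ∧ j ≠ l ∧ k ≠ l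

def SameRadial {α : Type*} (P Q : α → ℝ × ℝ) : Prop :=
  ∀ i j k l : α, Admissible i j k l → (Ccw P i j k l ↔ Ccw Q i j k l)

def SameUndirected {α : Type*} (P Q : α → ℝ × ℝ) : Prop :=
  ∀ i : α, (∀ j k l : α, Admissible i j k l → (Ccw Q i j k l ↔ Ccw P i j k l)) ∨
           (∀ j k l : α, Admissible i j k l → (Ccw Q i j k l ↔ Ccw P i l k j))

def ExtremeSet {α : Type*} (P : α → ℝ × ℝ) : Set α :=
  {i | P i ∉ convexHull ℝ (P '' {j | j ≠ i})}

def Important {n : ℕ} (P₀ : Fin n → ℝ × ℝ) (H : Set (Fin n)) : Prop :=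
  ∃ Q : Fin n → ℝ × ℝ, Function.Injective Q ∧ GenPos Q ∧ SameRadial P₀ Q ∧ ExtremeSet Q = H

def lineThrough (p q : ℝ × ℝ) : Set (ℝ × ℝ) := {x | ∃ t : ℝ, x = p + t • (q - p)}

theorem chi_rotate {α : Type*} (P : α → ℝ × ℝ) (i j k : α) : chi P j k i = chi P i j k := by
  unfold chi det2
  congr 1
  simp only [Prod.fst_sub, Prod.snd_sub]
  ring

theorem chi_swap {α : Type*} (P : α → ℝ × ℝ) (i j k : α) : chi P i k j = -chi P i j k := by
  unfold chi det2
  rw [← Real.sign_neg]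
  congr 1
  ring

theorem chi_eq_one_iff {α : Type*} (P : α → ℝ × ℝ) (i j k : α) :
    chi P i j k = 1 ↔ 0 < det2 (P j - P i) (P k - P i) := by
  unfold chi
  rcases lt_trichotomy (det2 (P j - P i) (P k - P i)) 0 with h | h | h
  · rw [Real.sign_of_neg h]
    constructor <;> intro <;> linarith
  · simp [h]
  · simp [Real.sign_of_pos h, h]

theorem chi_eq_one_of_subdivision {α : Type*} (P : α → ℝ × ℝ) {m a b c : α}
    (hab : chi P m a b = 1) (hbc : chi P m b c = 1) (hca : chi P m c a = 1) :
    chi P a b c = 1 := by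
  rw [chi_eq_one_iff] at *
  simp only [det2, Prod.fst_sub, Prod.snd_sub] at *
  linarith

theorem chi_eq_one_or_neg_one {α : Type*} {P : α → ℝ × ℝ} (hP : GenPos P) {i j k : α}
    (hij : i ≠ j) (hik : i ≠ k) (hjk : j ≠ k) : chi P i j k = 1 ∨ chi P i j k = -1 := by
  have h := hP i j k hij hik hjk
  rcases Real.sign_apply_eq (det2 (P j - P i) (P k - P i)) with h' | h' | h'
  · exact Or.inr h'
  · exact absurd h' h
  · exact Or.inl h'

/-- For four points in general position, the number of points whose radial relation holds,
with the remaining points listed in the order below, is odd. -/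
theorem ccw_iff_parity {α : Type*} {P : α → ℝ × ℝ} (hP : GenPos P) {m a b c : α}
    (h : Admissible m a b c) :
    Ccw P m a b c ↔ ¬(Ccw P a m b c ↔ (Ccw P b m c a ↔ Ccw P c m a b)) := by
  obtain ⟨hma, hmb, hmc, hab, hac, hbc⟩ := h
  have hpos := chi_eq_one_of_subdivision P (m := m) (a := a) (b := b) (c := c)
  have hneg := chi_eq_one_of_subdivision P (m := m) (a := a) (b := c) (c := b)
  rw [chi_swap P m c a, chi_swap P m b c, chi_swap P m a b, chi_swap P a b c] at hneg
  have ea : chi P a m b = -chi P m a b := by rw [← chi_rotate, chi_swap]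
  have ea' : chi P a c m = -chi P m c a := by rw [chi_rotate, chi_swap]
  have eb : chi P b m c = -chi P m b c := by rw [← chi_rotate, chi_swap]
  have eb' : chi P b a m = -chi P m a b := by rw [chi_rotate, chi_swap]
  have ec : chi P c m a = -chi P m c a := by rw [← chi_rotate, chi_swap]
  have ec' : chi P c b m = -chi P m b c := by rw [chi_rotate, chi_swap]
  have et : chi P b c a = chi P a b c := chi_rotate P a b c
  have et' : chi P c a b = chi P a b c := by rw [chi_rotate, chi_rotate]
  unfold Ccw
  rw [ea, ea', eb, eb', ec, ec', et, et']
  have one_ne : (-1 : ℝ) ≠ 1 := by norm_num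
  rcases chi_eq_one_or_neg_one hP hma hmb hab with u | u <;>
  rcases chi_eq_one_or_neg_one hP hmb hmc hbc with v | v <;>
  rcases chi_eq_one_or_neg_one hP hmc hma hac.symm with w | w <;>
  rcases chi_eq_one_or_neg_one hP hab hac hbc with t | t <;>
  simp [u, v, w, t, one_ne] at hpos hneg ⊢

/-- for 4 points, the radial relation at one point is determined
by the radial relations at the other three points. -/
theorem radial_fourth_determined
    (P Q : Fin 4 → ℝ × ℝ)
    (hPinj : Function.Injective P) (hPgp : GenPos P)
    (hQinj : Function.Injective Q) (hQgp : GenPos Q)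
    (i j k : Fin 4) (hij : i ≠ j) (hik : i ≠ k) (hjk : j ≠ k)
    (hi : ∀ j' k' l' : Fin 4, Admissible i j' k' l' → (Ccw P i j' k' l' ↔ Ccw Q i j' k' l'))
    (hj : ∀ j' k' l' : Fin 4, Admissible j j' k' l' → (Ccw P j j' k' l' ↔ Ccw Q j j' k' l'))
    (hk : ∀ j' k' l' : Fin 4, Admissible k j' k' l' → (Ccw P k j' k' l' ↔ Ccw Q k j' k' l'))
    (m : Fin 4) (hmi : m ≠ i) (hmj : m ≠ j) (hmk : m ≠ k) :
    ∀ j' k' l' : Fin 4, Admissible m j' k' l' → (Ccw P m j' k' l' ↔ Ccw Q m j' k' l') := by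
  have agree : ∀ a b c d : Fin 4, a ≠ m → Admissible a b c d → (Ccw P a b c d ↔ Ccw Q a b c d) := by
    intro a b c d ha h
    have : a = i ∨ a = j ∨ a = k := by omega
    rcases this with rfl | rfl | rfl
    · exact hi b c d h
    · exact hj b c d h
    · exact hk b c d h
  intro a b c h
  rw [ccw_iff_parity hPgp h, ccw_iff_parity hQgp h]
  obtain ⟨hma, hmb, hmc, hab, hac, hbc⟩ := h
  rw [agree a m b c hma.symm ⟨hma.symm, hab, hac, hmb, hmc, hbc⟩,
    agree b m c a hmb.symm ⟨hmb.symm, hbc, hab.symm, hmc, hma, hac.symm⟩,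
    agree c m a b hmc.symm ⟨hmc.symm, hac.symm, hbc.symm, hma, hmb, hab⟩]
end

section
/- Let n ≥ 5 and let P, Q : Fin n → ℝ² be two configurations of n labeled points (injective, in general position) with the same undirected radial system, i.e., for every index i the relation ccw_Q(i;·,·,·) equals ccw_P(i;·,·,·) or its reverse. If in addition P and Q have the same extreme set, then the chirotopes of P and Q are equivalent: either χ_P(i,j,k) = χ_Q(i,j,k) for all i,j,k, or χ_P(i,j,k) = −χ_Q(i,j,k) for all i,j,k. That is, the undirected radial system together with the set of convex hull labels determines the order type. -/
section Orientation

variable {α : Type*} {P Q : α → ℝ × ℝ} {a b c d : α}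

theorem chi_eq_one_iff_s9 :
    chi P a b c = 1 ↔ 0 < det2 (P b - P a) (P c - P a) := by
  unfold chi
  rcases lt_trichotomy (det2 (P b - P a) (P c - P a)) 0 with h | h | h
  · rw [Real.sign_of_neg h]
    exact ⟨fun h' => by norm_num at h', fun h' => absurd h h'.not_gt⟩
  · simp [h]
  · simp [Real.sign_of_pos h, h]

theorem chi_swap_s9 (P : α → ℝ × ℝ) (a b c : α) : chi P a c b = -chi P a b c := by
  unfold chi
  rw [← Real.sign_neg]
  congr 1
  simp only [det2]
  ring

theorem chi_rotate_s9 (P : α → ℝ × ℝ) (a b c : α) : chi P b c a = chi P a b c := by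
  unfold chi
  congr 1
  simp only [det2, Prod.fst_sub, Prod.snd_sub]
  ring

theorem chi_self_left (P : α → ℝ × ℝ) (a b : α) : chi P a a b = 0 := by
  simp [chi, det2]

theorem GenPos.chi_eq_one_or (hP : GenPos P) (hab : a ≠ b) (hac : a ≠ c) (hbc : b ≠ c) :
    chi P a b c = 1 ∨ chi P a b c = -1 := by
  have h := hP a b c hab hac hbc
  rcases Real.sign_apply_eq (det2 (P b - P a) (P c - P a)) with h' | h' | h'
  · exact Or.inr h'
  · exact absurd h' h
  · exact Or.inl h'

theorem GenPos.chi_swap_eq_one_iff (hP : GenPos P) (hab : a ≠ b) (hac : a ≠ c) (hbc : b ≠ c) :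
    chi P a c b = 1 ↔ ¬ chi P a b c = 1 := by
  rw [chi_swap_s9]
  rcases hP.chi_eq_one_or hab hac hbc with h | h <;> rw [h] <;> norm_num

/-- `d` sees `a, b, c` all with the same orientation, i.e. `d` lies inside the triangle `abc`. -/
def InTriangle (P : α → ℝ × ℝ) (a b c d : α) : Prop :=
  (chi P a b d = 1 ∧ chi P b c d = 1 ∧ ¬ chi P a c d = 1) ∨
  (¬ chi P a b d = 1 ∧ ¬ chi P b c d = 1 ∧ chi P a c d = 1)

/-- The orientations of a triangle seen from an inner point agree with the triangle's own. -/
theorem chi_acyclic (P : α → ℝ × ℝ) (a b c d : α) :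
    ((chi P a b d = 1 ∧ chi P b c d = 1 ∧ ¬ chi P a c d = 1) → chi P a b c = 1) ∧
    ((¬ chi P a b d = 1 ∧ ¬ chi P b c d = 1 ∧ chi P a c d = 1) → ¬ chi P a b c = 1) := by
  have key : det2 (P b - P a) (P c - P a) = det2 (P b - P a) (P d - P a)
      + det2 (P c - P b) (P d - P b) - det2 (P c - P a) (P d - P a) := by
    simp only [det2, Prod.fst_sub, Prod.snd_sub]
    ring
  simp only [chi_eq_one_iff_s9, not_lt]
  constructor <;> rintro ⟨h1, h2, h3⟩ <;> linarith

/-- The radial relations of four points in terms of the orientations of their triples. -/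
theorem GenPos.ccw_iff (hP : GenPos P) (h : Admissible a b c d) :
    (Ccw P a b c d ↔ (chi P a b c = 1 ∧ chi P a c d = 1) ∨
      (chi P a c d = 1 ∧ ¬ chi P a b d = 1) ∨ (¬ chi P a b d = 1 ∧ chi P a b c = 1)) ∧
    (Ccw P b a c d ↔ (¬ chi P a b c = 1 ∧ chi P b c d = 1) ∨
      (chi P b c d = 1 ∧ chi P a b d = 1) ∨ (chi P a b d = 1 ∧ ¬ chi P a b c = 1)) ∧
    (Ccw P c a b d ↔ (chi P a b c = 1 ∧ ¬ chi P b c d = 1) ∨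
      (¬ chi P b c d = 1 ∧ chi P a c d = 1) ∨ (chi P a c d = 1 ∧ chi P a b c = 1)) ∧
    (Ccw P d a b c ↔ (chi P a b d = 1 ∧ chi P b c d = 1) ∨
      (chi P b c d = 1 ∧ ¬ chi P a c d = 1) ∨ (¬ chi P a c d = 1 ∧ chi P a b d = 1)) := by
  obtain ⟨hab, hac, had, hbc, hbd, hcd⟩ := h
  have e1 : chi P b a c = chi P a c b := (chi_rotate_s9 P b a c).symm
  have e2 : chi P c b d = chi P b d c := (chi_rotate_s9 P c b d).symm
  have e3 : chi P d c a = chi P a d c := chi_rotate_s9 P a d c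
  have e4 : chi P d a b = chi P a b d := (chi_rotate_s9 P d a b).symm
  have e5 : chi P d b c = chi P b c d := (chi_rotate_s9 P d b c).symm
  have e6 : chi P c a b = chi P a b c := (chi_rotate_s9 P c a b).symm
  simp only [Ccw, e1, e2, e3, e4, e5, e6, chi_rotate_s9 P a b d, chi_rotate_s9 P a c d,
    hP.chi_swap_eq_one_iff hab had hbd, hP.chi_swap_eq_one_iff hab hac hbc,
    hP.chi_swap_eq_one_iff hac had hcd, hP.chi_swap_eq_one_iff hbc hbd hcd]
  simp only [and_self]

theorem GenPos.ccw_reverse (hP : GenPos P) (h : Admissible a b c d) :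
    Ccw P a d c b ↔ ¬ Ccw P a b c d := by
  obtain ⟨hab, hac, had, hbc, hbd, hcd⟩ := h
  simp only [Ccw, hP.chi_swap_eq_one_iff hac had hcd, hP.chi_swap_eq_one_iff hab hac hbc,
    hP.chi_swap_eq_one_iff hab had hbd]
  tauto

/-- An even number of the four (suitably ordered) radial relations of four points hold. -/
theorem GenPos.ccw_parity (hP : GenPos P) (h : Admissible a b c d) :
    (Ccw P a b c d ↔ Ccw P b a c d) ↔ (Ccw P c a b d ↔ Ccw P d a b c) := by
  obtain ⟨h1, h2, h3, h4⟩ := hP.ccw_iff h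
  obtain ⟨h5, h6⟩ := chi_acyclic P a b c d
  rw [h1, h2, h3, h4]
  clear h1 h2 h3 h4
  by_cases x : chi P a b c = 1 <;> by_cases y : chi P a b d = 1 <;>
    by_cases z : chi P a c d = 1 <;> by_cases w : chi P b c d = 1 <;> simp_all

/-- Two configurations of four points whose radial relations all agree, or all disagree, have the
corresponding orientations of `abc`, provided `d` is inside the triangle in both or in neither. -/
theorem chi_eq_one_iff_of_ccw_iff (hP : GenPos P) (hQ : GenPos Q) (h : Admissible a b c d)
    (hi : InTriangle P a b c d ↔ InTriangle Q a b c d) {F : Prop}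
    (hF : ∀ i j k l : α, Admissible i j k l → (Ccw Q i j k l ↔ (F ↔ Ccw P i j k l))) :
    chi Q a b c = 1 ↔ (F ↔ chi P a b c = 1) := by
  obtain ⟨p1, p2, p3, p4⟩ := hP.ccw_iff h
  obtain ⟨q1, q2, q3, q4⟩ := hQ.ccw_iff h
  have p5 := chi_acyclic P a b c d
  have q5 := chi_acyclic Q a b c d
  obtain ⟨hab, hac, had, hbc, hbd, hcd⟩ := h
  have ha := hF a b c d ⟨hab, hac, had, hbc, hbd, hcd⟩
  have hb := hF b a c d ⟨hab.symm, hbc, hbd, hac, had, hcd⟩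
  have hc := hF c a b d ⟨hac.symm, hbc.symm, hcd, hab, had, hbd⟩
  have hd := hF d a b c ⟨had.symm, hbd.symm, hcd.symm, hab, hac, hbc⟩
  rw [p1, q1] at ha
  rw [p2, q2] at hb
  rw [p3, q3] at hc
  rw [p4, q4] at hd
  unfold InTriangle at hi
  clear p1 p2 p3 p4 q1 q2 q3 q4 hF hab hac had hbc hbd hcd hP hQ
  generalize (chi P a b c = 1) = x at *
  generalize (chi P a b d = 1) = y at *
  generalize (chi P a c d = 1) = z at *
  generalize (chi P b c d = 1) = w at *
  generalize (chi Q a b c = 1) = x' at *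
  generalize (chi Q a b d = 1) = y' at *
  generalize (chi Q a c d = 1) = z' at *
  generalize (chi Q b c d = 1) = w' at *
  grind

/-- In general position, lying in a closed triangle is detected by orientations. -/
theorem GenPos.mem_convexHull_iff (hP : GenPos P) (h : Admissible a b c d) :
    P d ∈ convexHull ℝ {P a, P b, P c} ↔ InTriangle P a b c d := by
  obtain ⟨hab, hac, had, hbc, hbd, hcd⟩ := h
  have hne {i j k : α} (hij : i ≠ j) (hik : i ≠ k) (hjk : j ≠ k) :
      det2 (P j - P i) (P k - P i) ≠ 0 := fun h0 =>
    hP i j k hij hik hjk (by rw [chi, h0, Real.sign_zero])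
  have nE := hne hab hac hbc
  have nA := hne hbc hbd hcd
  have nB := hne hac had hcd
  have nC := hne hab had hbd
  simp only [InTriangle, chi_eq_one_iff_s9, not_lt]
  constructor
  · intro hd
    rw [convexHull_insert (by simp), convexHull_pair] at hd
    simp only [mem_convexJoin, Set.mem_singleton_iff, exists_eq_left] at hd
    obtain ⟨q, ⟨s, t, hs, ht, hst, rfl⟩, u, v, hu, hv, huv, hd⟩ := hd
    obtain rfl : u = 1 - v := by linarith
    obtain rfl : s = 1 - t := by linarith
    have eA : det2 (P c - P b) (P d - P b) = (1 - v) * det2 (P b - P a) (P c - P a) := by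
      rw [← hd]; simp only [det2, Prod.fst_sub, Prod.snd_sub, Prod.fst_add, Prod.snd_add,
        Prod.smul_fst, Prod.smul_snd, smul_eq_mul]; ring
    have eB : det2 (P c - P a) (P d - P a) =
        -(v * (1 - t) * det2 (P b - P a) (P c - P a)) := by
      rw [← hd]; simp only [det2, Prod.fst_sub, Prod.snd_sub, Prod.fst_add, Prod.snd_add,
        Prod.smul_fst, Prod.smul_snd, smul_eq_mul]; ring
    have eC : det2 (P b - P a) (P d - P a) = v * t * det2 (P b - P a) (P c - P a) := by
      rw [← hd]; simp only [det2, Prod.fst_sub, Prod.snd_sub, Prod.fst_add, Prod.snd_add,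
        Prod.smul_fst, Prod.smul_snd, smul_eq_mul]; ring
    have hvs := mul_nonneg hv hs
    have hvt := mul_nonneg hv ht
    rcases nE.lt_or_gt with hE | hE
    · right
      refine ⟨?_, ?_, lt_of_le_of_ne ?_ nB.symm⟩
      · rw [eC]; exact mul_nonpos_of_nonneg_of_nonpos hvt hE.le
      · rw [eA]; exact mul_nonpos_of_nonneg_of_nonpos hu hE.le
      · rw [eB]; exact neg_nonneg.2 (mul_nonpos_of_nonneg_of_nonpos hvs hE.le)
    · left
      refine ⟨lt_of_le_of_ne ?_ nC.symm, lt_of_le_of_ne ?_ nA.symm, ?_⟩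
      · rw [eC]; exact mul_nonneg hvt hE.le
      · rw [eA]; exact mul_nonneg hu hE.le
      · rw [eB]; exact neg_nonpos.2 (mul_nonneg hvs hE.le)
  · intro hd
    set A := det2 (P c - P b) (P d - P b) with hA
    set B := det2 (P c - P a) (P d - P a) with hB
    set C := det2 (P b - P a) (P d - P a) with hC
    set E := det2 (P b - P a) (P c - P a) with hE
    have key : E = C + A - B := by
      simp only [hA, hB, hC, hE, det2, Prod.fst_sub, Prod.snd_sub]; ring
    have e : P d = (A / E) • P a + (-B / E) • P b + (C / E) • P c := by
      ext
      · simp only [Prod.fst_add, Prod.smul_fst, smul_eq_mul]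
        field_simp
        simp only [hA, hB, hC, hE, det2, Prod.fst_sub, Prod.snd_sub]; ring
      · simp only [Prod.snd_add, Prod.smul_snd, smul_eq_mul]
        field_simp
        simp only [hA, hB, hC, hE, det2, Prod.fst_sub, Prod.snd_sub]; ring
    have hw : 0 ≤ A / E ∧ 0 ≤ -B / E ∧ 0 ≤ C / E := by
      rcases hd with ⟨h1, h2, h3⟩ | ⟨h1, h2, h3⟩
      · have : 0 ≤ E := by linarith
        exact ⟨div_nonneg h2.le this, div_nonneg (by linarith) this, div_nonneg h1.le this⟩
      · have : E ≤ 0 := by linarith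
        exact ⟨div_nonneg_of_nonpos h2 this, div_nonneg_of_nonpos (by linarith) this,
          div_nonneg_of_nonpos h1 this⟩
    have hsum : A / E + -B / E + C / E = 1 := by
      field_simp; linarith
    have hsub : ∀ x ∈ ({P a, P b, P c} : Set (ℝ × ℝ)), x ∈ convexHull ℝ {P a, P b, P c} :=
      fun x hx => subset_convexHull ℝ _ hx
    rw [e]
    have := (convex_convexHull ℝ ({P a, P b, P c} : Set (ℝ × ℝ))).sum_mem
      (t := Finset.univ) (w := ![A / E, -B / E, C / E]) (z := ![P a, P b, P c])
      (by intro i _; fin_cases i <;> simp [hw])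
      (by simpa [Fin.sum_univ_three] using hsum)
      (by intro i _; fin_cases i <;> exact hsub _ (by simp))
    simpa [Fin.sum_univ_three] using this

theorem GenPos.not_inTriangle_of_mem_extremeSet (hP : GenPos P) (h : Admissible a b c d)
    (hd : d ∈ ExtremeSet P) : ¬ InTriangle P a b c d := by
  rw [← hP.mem_convexHull_iff h]
  obtain ⟨-, -, had, -, hbd, hcd⟩ := h
  refine fun h' => hd (convexHull_mono ?_ h')
  rintro x (rfl | rfl | rfl)
  exacts [⟨a, had, rfl⟩, ⟨b, hbd, rfl⟩, ⟨c, hcd, rfl⟩]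

/-- A finite configuration is contained in the convex hull of its extreme points. -/
theorem mem_convexHull_image_extremeSet [Finite α] (hP : Function.Injective P) (d : α) :
    P d ∈ convexHull ℝ (P '' ExtremeSet P) := by
  have hfin : (Set.range P).Finite := Set.finite_range P
  have hsub : (convexHull ℝ (Set.range P)).extremePoints ℝ ⊆ P '' ExtremeSet P := by
    intro x hx
    obtain ⟨i, rfl⟩ := extremePoints_convexHull_subset hx
    refine ⟨i, fun hi => ?_, rfl⟩
    have h := ((convex_convexHull ℝ _).mem_extremePoints_iff_mem_sdiff_convexHull_sdiff.1 hx).2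
    refine h (convexHull_mono ?_ hi)
    rintro _ ⟨j, hj, rfl⟩
    exact ⟨subset_convexHull ℝ _ ⟨j, rfl⟩, fun e => hj (hP e)⟩
  have hKM := closure_convexHull_extremePoints (hfin.isCompact_convexHull ℝ)
    (convex_convexHull ℝ (Set.range P))
  have hclosed : IsClosed (convexHull ℝ (P '' ExtremeSet P)) :=
    ((Set.toFinite (ExtremeSet P)).image P).isClosed_convexHull ℝ
  have hd : P d ∈ convexHull ℝ (Set.range P) := subset_convexHull ℝ _ ⟨d, rfl⟩
  rw [← hKM] at hd
  exact closure_minimal (convexHull_mono hsub) hclosed hd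

theorem GenPos.inTriangle_of_extremeSet_subset [Finite α] (hP : GenPos P)
    (hinj : Function.Injective P) (h : Admissible a b c d)
    (hE : ExtremeSet P ⊆ {a, b, c}) : InTriangle P a b c d := by
  rw [← hP.mem_convexHull_iff h]
  refine convexHull_mono ?_ (mem_convexHull_image_extremeSet hinj d)
  rintro _ ⟨i, hi, rfl⟩
  rcases hE hi with rfl | rfl | rfl <;> simp

/-- Every triple can be completed by a point whose position relative to the triangle is
determined by the extreme set. -/
theorem exists_inTriangle_iff {n : ℕ} (hn : 4 ≤ n) {P Q : Fin n → ℝ × ℝ}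
    (hPinj : Function.Injective P) (hP : GenPos P)
    (hQinj : Function.Injective Q) (hQ : GenPos Q) (hext : ExtremeSet P = ExtremeSet Q)
    {a b c : Fin n} (hab : a ≠ b) (hac : a ≠ c) (hbc : b ≠ c) :
    ∃ d, Admissible a b c d ∧ (InTriangle P a b c d ↔ InTriangle Q a b c d) := by
  by_cases hE : ExtremeSet P ⊆ {a, b, c}
  · have hcard : ({a, b, c} : Finset (Fin n)).card < Fintype.card (Fin n) := by
      rw [Fintype.card_fin]
      exact Finset.card_le_three.trans_lt hn
    obtain ⟨d, hd⟩ := Finset.exists_mem_notMem_of_card_lt_card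
      (s := {a, b, c}) (t := Finset.univ) (by simpa using hcard)
    have h : Admissible a b c d := by
      simp only [Finset.mem_insert, Finset.mem_singleton] at hd
      refine ⟨hab, hac, ?_, hbc, ?_, ?_⟩ <;> rintro rfl <;> simp at hd
    exact ⟨d, h, iff_of_true (hP.inTriangle_of_extremeSet_subset hPinj h hE)
      (hQ.inTriangle_of_extremeSet_subset hQinj h (hext ▸ hE))⟩
  · obtain ⟨d, hd, hd'⟩ := Set.not_subset.1 hE
    have h : Admissible a b c d := by
      refine ⟨hab, hac, ?_, hbc, ?_, ?_⟩ <;> rintro rfl <;> simp at hd'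
    exact ⟨d, h, iff_of_false (hP.not_inTriangle_of_mem_extremeSet h hd)
      (hQ.not_inTriangle_of_mem_extremeSet h (hext ▸ hd))⟩

theorem forall_chi_of_forall_distinct {s : ℝ}
    (h : ∀ a b c : α, a ≠ b → a ≠ c → b ≠ c → chi P a b c = s * chi Q a b c) (a b c : α) :
    chi P a b c = s * chi Q a b c := by
  by_cases hab : a = b
  · subst hab; simp [chi_self_left]
  by_cases hac : a = c
  · subst hac; simp [chi_swap_s9 _ a a b, chi_self_left]
  by_cases hbc : b = c
  · subst hbc; simp [← chi_rotate_s9 _ a b b, chi_self_left]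
  exact h a b c hab hac hbc

/-- For at least five points, the undirected radial system determines the radial system up to
one global reversal. -/
theorem SameUndirected.global {n : ℕ} (hn : 5 ≤ n) {P Q : Fin n → ℝ × ℝ}
    (hP : GenPos P) (hQ : GenPos Q) (hU : SameUndirected P Q) :
    ∃ F : Prop, ∀ i j k l, Admissible i j k l → (Ccw Q i j k l ↔ (F ↔ Ccw P i j k l)) := by
  have hsign : ∀ i, ∃ F : Prop, ∀ j k l, Admissible i j k l →
      (Ccw Q i j k l ↔ (F ↔ Ccw P i j k l)) := by
    intro i
    rcases hU i with h | h
    · exact ⟨True, fun j k l hA => by rw [h j k l hA, true_iff]⟩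
    · exact ⟨False, fun j k l hA => by rw [h j k l hA, hP.ccw_reverse hA, false_iff]⟩
  choose F hF using hsign
  have hpar : ∀ a b c d, Admissible a b c d → ((F a ↔ F b) ↔ (F c ↔ F d)) := by
    intro a b c d h
    have p := hP.ccw_parity h
    have q := hQ.ccw_parity h
    obtain ⟨hab, hac, had, hbc, hbd, hcd⟩ := h
    rw [hF a b c d ⟨hab, hac, had, hbc, hbd, hcd⟩,
      hF b a c d ⟨hab.symm, hbc, hbd, hac, had, hcd⟩,
      hF c a b d ⟨hac.symm, hbc.symm, hcd, hab, had, hbd⟩,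
      hF d a b c ⟨had.symm, hbd.symm, hcd.symm, hab, hac, hbc⟩] at q
    grind
  have hconst : ∀ i j, F i ↔ F j := by
    intro i j
    by_cases hij : i = j
    · rw [hij]
    obtain ⟨t, ht, htc⟩ := Finset.exists_subset_card_eq
      (s := (Finset.univ \ {i, j} : Finset (Fin n))) (n := 3) (by
        rw [Finset.card_sdiff_of_subset (Finset.subset_univ _), Finset.card_pair hij,
          Finset.card_univ, Fintype.card_fin]
        omega)
    obtain ⟨x, y, z, hxy, hxz, hyz, rfl⟩ := Finset.card_eq_three.1 htc
    have hx := ht (show x ∈ _ by simp)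
    have hy := ht (show y ∈ _ by simp)
    have hz := ht (show z ∈ _ by simp)
    simp only [Finset.mem_sdiff, Finset.mem_univ, true_and, Finset.mem_insert,
      Finset.mem_singleton, not_or] at hx hy hz
    have h1 := hpar i x y z ⟨Ne.symm hx.1, Ne.symm hy.1, Ne.symm hz.1, hxy, hxz, hyz⟩
    have h2 := hpar j x y z ⟨Ne.symm hx.2, Ne.symm hy.2, Ne.symm hz.2, hxy, hxz, hyz⟩
    tauto
  refine ⟨F ⟨0, by omega⟩, fun i j k l hA => ?_⟩
  rw [hF i j k l hA, hconst i]

end Orientation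

/-- the undirected radial system together with the set of convex
hull labels determines the order type. -/
theorem undirected_and_hull_determine_order_type {n : ℕ} (hn : 5 ≤ n)
    (P Q : Fin n → ℝ × ℝ)
    (hPinj : Function.Injective P) (hPgp : GenPos P)
    (hQinj : Function.Injective Q) (hQgp : GenPos Q)
    (hU : SameUndirected P Q)
    (hext : ExtremeSet P = ExtremeSet Q) :
    (∀ i j k : Fin n, chi P i j k = chi Q i j k) ∨
    (∀ i j k : Fin n, chi P i j k = - chi Q i j k) := by
  obtain ⟨F, hF⟩ := hU.global hn hPgp hQgp
  have hchi : ∀ a b c : Fin n, a ≠ b → a ≠ c → b ≠ c →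
      (chi Q a b c = 1 ↔ (F ↔ chi P a b c = 1)) := fun a b c hab hac hbc => by
    obtain ⟨d, hA, hi⟩ := exists_inTriangle_iff (by omega) hPinj hPgp hQinj hQgp hext hab hac hbc
    exact chi_eq_one_iff_of_ccw_iff hPgp hQgp hA hi hF
  by_cases h : F
  · left
    simpa using forall_chi_of_forall_distinct (P := P) (Q := Q) (s := 1) fun a b c hab hac hbc => by
      have key := hchi a b c hab hac hbc
      rcases hPgp.chi_eq_one_or hab hac hbc with hp | hp <;>
        rcases hQgp.chi_eq_one_or hab hac hbc with hq | hq <;>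
        rw [hp, hq] at key ⊢ <;> revert key <;> norm_num [h]
  · right
    simpa using forall_chi_of_forall_distinct (P := P) (Q := Q) (s := -1)
      fun a b c hab hac hbc => by
        have key := hchi a b c hab hac hbc
        rcases hPgp.chi_eq_one_or hab hac hbc with hp | hp <;>
          rcases hQgp.chi_eq_one_or hab hac hbc with hq | hq <;>
          rw [hp, hq] at key ⊢ <;> revert key <;> norm_num [h]
end
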